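/- The Kauffman monoid K_3 and the monoid S_2^1 (the semigroup S_2 with an identity element adjoined) satisfy exactly the same identities: an identity w ≍ w' holds in K_3 if and only if it holds in S_2^1. -/

import Mathlib

open scoped Classical

/-- Generators of the Kauffman monoid `K₃`. -/
inductive K3Gen : Type
  | h1 | h2 | c
deriving DecidableEq

namespace K3Gen

/-- The defining relations of the Kauffman monoid `K₃`:
`h₁h₂h₁ = h₁`, `h₂h₁h₂ = h₂`, `h₁² = ch₁ = h₁c`, `h₂² = ch₂ = h₂c`. -/
inductive K3Rel : FreeMonoid K3Gen → FreeMonoid K3Gen → Prop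
  | braid1 : K3Rel (.of h1 * .of h2 * .of h1) (.of h1)
  | braid2 : K3Rel (.of h2 * .of h1 * .of h2) (.of h2)
  | sq1 : K3Rel (.of h1 * .of h1) (.of c * .of h1)
  | comm1 : K3Rel (.of c * .of h1) (.of h1 * .of c)
  | sq2 : K3Rel (.of h2 * .of h2) (.of c * .of h2)
  | comm2 : K3Rel (.of c * .of h2) (.of h2 * .of c)

end K3Gen

/-- The congruence on the free monoid over the generators generated by the relations. -/
def K3Con : Con (FreeMonoid K3Gen) := conGen K3Gen.K3Rel

/-- The Kauffman monoid `K₃`. -/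
def K3 : Type := K3Con.Quotient

instance : Monoid K3 := Con.monoid K3Con

namespace K3

/-- The generator `h₁` of `K₃`. -/
def h1 : K3 := K3Con.mk' (.of .h1)
/-- The generator `h₂` of `K₃`. -/
def h2 : K3 := K3Con.mk' (.of .h2)
/-- The generator `c` of `K₃`. -/
def c : K3 := K3Con.mk' (.of .c)

end K3

/-- The identity `w ≍ w'` (words over the countably infinite alphabet `ℕ`) holds in the
monoid `M` if every monoid homomorphism from the free monoid over `ℕ` to `M` equalizes
`w` and `w'`. -/
def HoldsIn (M : Type*) [Monoid M] (w w' : List ℕ) : Prop :=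
  ∀ φ : FreeMonoid ℕ →* M, φ (FreeMonoid.ofList w) = φ (FreeMonoid.ofList w')

/-- Generators of the monoid `S₂¹`. -/
inductive S2Gen : Type
  | e | f

/-- The defining relations `e² = e`, `f² = f`. -/
inductive S21Rel : FreeMonoid S2Gen → FreeMonoid S2Gen → Prop
  | idem_e : S21Rel (.of .e * .of .e) (.of .e)
  | idem_f : S21Rel (.of .f * .of .f) (.of .f)

/-- The congruence on the free monoid generated by the relations. -/
def S21Con : Con (FreeMonoid S2Gen) := conGen S21Rel

/-- The monoid `S₂¹ = ⟨e, f ∣ e² = e, f² = f⟩`, i.e. the free product of two trivial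
semigroups with an identity element adjoined. -/
def S21 : Type := S21Con.Quotient

instance : Monoid S21 := Con.monoid S21Con

/-- Multiplication in the rectangular band with identity. -/
def rmul : Option (Bool × Bool) → Option (Bool × Bool) → Option (Bool × Bool)
  | none, b => b
  | some a, none => some a
  | some a, some b => some (a.1, b.2)

/-- The cocycle. -/
def dl (t : Bool) : Option (Bool × Bool) → Option (Bool × Bool) → ℕ
  | none, _ => 0
  | some _, none => 0
  | some a, some b => if (a.2 == b.1) = t then 1 else 0

/-- The length of an element of the band. -/
def ln : Option (Bool × Bool) → ℕ
  | none => 0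
  | some _ => 1

/-- Model monoid: extension of the band by the naturals. -/
@[ext] structure MM (t : Bool) where
  n : ℕ
  r : Option (Bool × Bool)

instance (t : Bool) : Mul (MM t) := ⟨fun a b => ⟨a.n + b.n + dl t a.r b.r, rmul a.r b.r⟩⟩

instance (t : Bool) : One (MM t) := ⟨⟨0, none⟩⟩

theorem MM.mul_mk {t : Bool} (a b : MM t) :
    a * b = ⟨a.n + b.n + dl t a.r b.r, rmul a.r b.r⟩ := rfl

theorem MM.one_mk {t : Bool} : (1 : MM t) = ⟨0, none⟩ := rfl

instance (t : Bool) : Monoid (MM t) where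
  mul_assoc a b c := by
    obtain ⟨a, x⟩ := a
    obtain ⟨b, y⟩ := b
    obtain ⟨c, z⟩ := c
    rcases x with _ | x <;> rcases y with _ | y <;> rcases z with _ | z <;>
      simp only [MM.mul_mk, rmul, dl, MM.mk.injEq, and_true] <;> omega
  one_mul a := by
    rw [MM.mul_mk, MM.one_mk]
    ext1 <;> simp [rmul, dl]
  mul_one a := by
    obtain ⟨a, x⟩ := a
    rw [MM.mul_mk, MM.one_mk]
    rcases x with _ | x <;> simp [rmul, dl]

/-- Product of the band components along a word. -/
def pr (r : ℕ → Option (Bool × Bool)) : List ℕ → Option (Bool × Bool)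
  | [] => none
  | x :: l => rmul (r x) (pr r l)

/-- Accumulated cocycle along a word. -/
def cnt (t : Bool) (r : ℕ → Option (Bool × Bool)) : List ℕ → ℕ
  | [] => 0
  | x :: l => dl t (r x) (pr r l) + cnt t r l

theorem eval_eq {t : Bool} (φ : FreeMonoid ℕ →* MM t) (w : List ℕ) :
    φ (FreeMonoid.ofList w) =
      ⟨(w.map fun x => (φ (.of x)).n).sum + cnt t (fun x => (φ (.of x)).r) w,
        pr (fun x => (φ (.of x)).r) w⟩ := by
  induction w with
  | nil => rw [FreeMonoid.ofList_nil, map_one]; rfl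
  | cons x l ih =>
    rw [FreeMonoid.ofList_cons, map_mul, ih, MM.mul_mk]
    simp only [List.map_cons, List.sum_cons, cnt, pr, MM.mk.injEq, and_true]
    omega

theorem cnt_add (r : ℕ → Option (Bool × Bool)) (w : List ℕ) :
    cnt true r w + cnt false r w + ln (pr r w) = (w.map fun x => ln (r x)).sum := by
  induction w with
  | nil => rfl
  | cons x l ih =>
    simp only [List.map_cons, List.sum_cons, ← ih, cnt, pr]
    generalize r x = a
    generalize pr r l = b
    rcases a with _ | ⟨a1, a2⟩ <;> rcases b with _ | ⟨b1, b2⟩ <;> simp only [dl, ln, rmul]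
    · omega
    · omega
    · omega
    · cases a2 <;> cases b1 <;> simp <;> omega

/-- Combinatorial form of the identity. -/
def Good (t : Bool) (w w' : List ℕ) : Prop :=
  w.Perm w' ∧ ∀ r, cnt t r w = cnt t r w' ∧ pr r w = pr r w'

theorem Good.holds {t : Bool} {w w' : List ℕ} (h : Good t w w') : HoldsIn (MM t) w w' := by
  intro φ
  rw [eval_eq, eval_eq, (h.2 _).1, (h.2 _).2, (h.1.map _).sum_eq]

theorem good_iff {w w' : List ℕ} : Good true w w' ↔ Good false w w' := by
  constructor <;> rintro ⟨h, h'⟩ <;> refine ⟨h, fun r => ⟨?_, (h' r).2⟩⟩ <;>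
  · have h1 := cnt_add r w
    have h2 := cnt_add r w'
    rw [(h.map fun x => ln (r x)).sum_eq, ← h2, (h' r).2, (h' r).1] at h1
    omega

theorem HoldsIn.of_inj {M N : Type} [Monoid M] [Monoid N] (f : M →* N)
    (hf : Function.Injective f) {w w' : List ℕ} (h : HoldsIn N w w') : HoldsIn M w w' :=
  fun φ => hf (h (f.comp φ))

theorem lift_ofList {M : Type} [Monoid M] (F : ℕ → M) (w : List ℕ) :
    FreeMonoid.lift F (FreeMonoid.ofList w) = (w.map F).prod := by
  rw [FreeMonoid.lift_ofList]

/-! ### The monoid `K3` -/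

/-- Images of generators. -/
def kgen : K3Gen → MM true
  | .h1 => ⟨0, some (true, true)⟩
  | .h2 => ⟨0, some (false, false)⟩
  | .c => ⟨1, none⟩

/-- Map to the model. -/
def kmap : K3 →* MM true :=
  K3Con.lift (FreeMonoid.lift kgen) (by
    refine Con.conGen_le.2 ?_
    intro x y h
    cases h <;> rfl)

/-- Generator as an element. -/
def kg (x : K3Gen) : K3 := K3Con.mk' (.of x)

theorem kmap_kg (x : K3Gen) : kmap (kg x) = kgen x := by
  cases x <;> rfl

theorem krel {a b : FreeMonoid K3Gen} (h : K3Gen.K3Rel a b) : K3Con.mk' a = K3Con.mk' b :=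
  (Con.eq _).2 (ConGen.Rel.of _ _ h)

open K3Gen in
theorem kbraid1 : kg h1 * kg h2 * kg h1 = kg h1 := krel .braid1
open K3Gen in
theorem kbraid2 : kg h2 * kg h1 * kg h2 = kg h2 := krel .braid2
open K3Gen in
theorem ksq1 : kg h1 * kg h1 = kg c * kg h1 := krel .sq1
open K3Gen in
theorem kcomm1 : kg c * kg h1 = kg h1 * kg c := krel .comm1
open K3Gen in
theorem ksq2 : kg h2 * kg h2 = kg c * kg h2 := krel .sq2
open K3Gen in
theorem kcomm2 : kg c * kg h2 = kg h2 * kg c := krel .comm2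

/-- `h` generator by Boolean. -/
def hh (b : Bool) : K3 := if b then kg .h1 else kg .h2

/-- Diagram elements. -/
def kH : Bool × Bool → K3
  | (true, true) => kg .h1
  | (false, false) => kg .h2
  | (true, false) => kg .h1 * kg .h2
  | (false, true) => kg .h2 * kg .h1

/-- Section over the band. -/
def kR : Option (Bool × Bool) → K3
  | none => 1
  | some a => kH a

theorem kmap_kR (a : Option (Bool × Bool)) : kmap (kR a) = ⟨0, a⟩ := by
  rcases a with _ | ⟨_ | _, _ | _⟩ <;> rfl

/-- Normal form map. -/
def kN (m : MM true) : K3 := kg .c ^ m.n * kR m.r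

theorem hh_kR (g : Bool) (r : Option (Bool × Bool)) :
    hh g * kR r = kg .c ^ (dl true (some (g, g)) r) * kR (rmul (some (g, g)) r) := by
  rcases r with _ | ⟨_ | _, _ | _⟩ <;> cases g <;>
    simp [hh, kR, kH, dl, rmul, ksq1, ksq2, kbraid1, kbraid2, ← mul_assoc]

theorem hh_comm (g : Bool) (n : ℕ) : hh g * kg .c ^ n = kg .c ^ n * hh g := by
  have : Commute (hh g) (kg .c) := by
    cases g
    · exact kcomm2.symm
    · exact kcomm1.symm
  exact (this.pow_right n).eq

theorem kN_hh (g : Bool) (m : MM true) : kN (⟨0, some (g, g)⟩ * m) = hh g * kN m := by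
  rw [MM.mul_mk]
  simp only [kN]
  rw [← mul_assoc, hh_comm, mul_assoc, hh_kR, zero_add, pow_add, mul_assoc]

theorem kN_gen (x : K3Gen) (m : MM true) : kN (kgen x * m) = kg x * kN m := by
  cases x
  · exact kN_hh true m
  · exact kN_hh false m
  · rw [MM.mul_mk]
    simp only [kN, kgen, dl, rmul, add_zero, pow_add, pow_one, mul_assoc]

/-- Quotient map. -/
def kq (w : FreeMonoid K3Gen) : K3 := K3Con.mk' w

theorem kN_kmap (s : K3) : kN (kmap s) = s := by
  induction s using Con.induction_on with
  | _ w =>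
    induction w using FreeMonoid.inductionOn' with
    | one => change kN 1 = 1; simp [kN, MM.one_mk, kR]
    | of_mul x w ih =>
      change kN (kmap (kg x * kq w)) = kg x * kq w
      rw [map_mul, kmap_kg, kN_gen]
      exact congrArg _ ih

theorem kgood {w w' : List ℕ} (h : HoldsIn K3 w w') : Good true w w' := by
  constructor
  · rw [List.perm_iff_count]
    intro a
    have h1 := congrArg kmap (h (FreeMonoid.lift fun x => if x = a then kg .c else 1))
    have key : ∀ l : List ℕ, kmap (FreeMonoid.lift (fun x => if x = a then kg .c else 1)
        (FreeMonoid.ofList l)) = ⟨l.count a, none⟩ := by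
      intro l
      induction l with
      | nil => rfl
      | cons x l ih =>
        rw [FreeMonoid.ofList_cons, map_mul, map_mul, ih, FreeMonoid.lift_eval_of]
        split_ifs with hx
        · subst hx
          rw [kmap_kg, MM.mul_mk]
          simp [kgen, dl, rmul, add_comm]
        · rw [map_one, one_mul, List.count_cons_of_ne hx]
    rw [key, key] at h1
    exact congrArg MM.n h1
  · intro r
    have h1 : (kmap.comp (FreeMonoid.lift fun x => kR (r x))) (FreeMonoid.ofList w) =
      (kmap.comp (FreeMonoid.lift fun x => kR (r x))) (FreeMonoid.ofList w') :=
        congrArg kmap (h (FreeMonoid.lift fun x => kR (r x)))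
    rw [eval_eq, eval_eq] at h1
    simpa [kmap_kR] using h1

/-! ### The monoid `S21` -/

/-- Generator by Boolean. -/
def sb : Bool → S2Gen
  | true => .e
  | false => .f

/-- Images of generators. -/
def sgen : S2Gen → MM false
  | .e => ⟨0, some (true, true)⟩
  | .f => ⟨0, some (false, false)⟩

/-- Map to the model. -/
def smap : S21 →* MM false :=
  S21Con.lift (FreeMonoid.lift sgen) (by
    refine Con.conGen_le.2 ?_
    intro x y h
    cases h <;> rfl)

/-- Generator as an element. -/
def sg (b : Bool) : S21 := S21Con.mk' (.of (sb b))

theorem smap_sg (b : Bool) : smap (sg b) = ⟨0, some (b, b)⟩ := by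
  cases b <;> rfl

theorem sg_idem (b : Bool) : sg b * sg b = sg b := by
  cases b
  · exact (Con.eq _).2 (ConGen.Rel.of _ _ S21Rel.idem_f)
  · exact (Con.eq _).2 (ConGen.Rel.of _ _ S21Rel.idem_e)

/-- Alternating words. -/
def alt : ℕ → Bool → S21
  | 0, b => sg b
  | n + 1, b => sg b * alt n (!b)

/-- Normal form map. -/
def sN (m : MM false) : S21 :=
  match m.r with
  | none => 1
  | some a => alt m.n a.1

theorem sN_sg (b : Bool) (m : MM false) (hm : m.r = none → m.n = 0) :
    sN (⟨0, some (b, b)⟩ * m) = sg b * sN m := by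
  obtain ⟨n, r⟩ := m
  rw [MM.mul_mk]
  rcases r with _ | ⟨i, j⟩
  · obtain rfl : n = 0 := hm rfl
    simp [sN, rmul, dl, alt]
  · by_cases hb : b = i
    · subst hb
      simp only [sN, rmul, dl]
      cases n <;> simp [alt, sg_idem, ← mul_assoc]
    · obtain rfl : i = !b := by cases b <;> cases i <;> simp_all
      simp [sN, rmul, dl, alt]

/-- Quotient map. -/
def sqt (w : FreeMonoid S2Gen) : S21 := S21Con.mk' w

theorem sN_smap (s : S21) : sN (smap s) = s ∧ ((smap s).r = none → (smap s).n = 0) := by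
  induction s using Con.induction_on with
  | _ w =>
    induction w using FreeMonoid.inductionOn' with
    | one => exact ⟨rfl, fun _ => rfl⟩
    | of_mul x w ih =>
      obtain ⟨b, rfl⟩ : ∃ b, x = sb b := by
        cases x
        · exact ⟨true, rfl⟩
        · exact ⟨false, rfl⟩
      change sN (smap (sg b * sqt w)) = sg b * sqt w ∧
        ((smap (sg b * sqt w)).r = none → (smap (sg b * sqt w)).n = 0)
      rw [map_mul, smap_sg, sN_sg b (smap (sqt w)) ih.2]
      refine ⟨congrArg _ ih.1, ?_⟩
      rw [MM.mul_mk]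
      generalize smap (sqt w) = m
      obtain ⟨n, r⟩ := m
      rcases r with _ | r <;> simp [rmul]

/-- Section over the band. -/
def sR : Option (Bool × Bool) → S21
  | none => 1
  | some a => sg a.1 * sg a.2

/-- Weight of the section. -/
def sw : Option (Bool × Bool) → ℕ
  | none => 0
  | some a => if a.1 = a.2 then 0 else 1

theorem smap_sR (a : Option (Bool × Bool)) : smap (sR a) = ⟨sw a, a⟩ := by
  rcases a with _ | ⟨_ | _, _ | _⟩ <;> simp [sR, smap_sg, MM.mul_mk, dl, rmul, sw, MM.one_mk]

theorem sgood {w w' : List ℕ} (h : HoldsIn S21 w w') : Good false w w' := by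
  have hp : w.Perm w' := by
    rw [List.perm_iff_count]
    intro a
    have h1 := congrArg smap
      (h (FreeMonoid.lift fun x => if x = a then sR (some (true, false)) else 1))
    have key : ∀ l : List ℕ, smap (FreeMonoid.lift
        (fun x => if x = a then sR (some (true, false)) else 1) (FreeMonoid.ofList l)) =
        if l.count a = 0 then ⟨0, none⟩ else ⟨2 * l.count a - 1, some (true, false)⟩ := by
      intro l
      induction l with
      | nil => rfl
      | cons x l ih =>
        rw [FreeMonoid.ofList_cons, map_mul, map_mul, ih, FreeMonoid.lift_eval_of]
        split_ifs with hx h2 h3 h3 h2 h3 h3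
        all_goals first
          | (rw [List.count_cons_of_ne hx] at h3; contradiction)
          | (subst hx; simp at h3; done)
          | (subst hx; rw [smap_sR, MM.mul_mk]; simp [sw, dl, rmul, h2]; try omega)
          | (rw [map_one, one_mul, List.count_cons_of_ne hx])
          | (rw [map_one, one_mul])
    rw [key, key] at h1
    split_ifs at h1 with h2 h3 h3
    · omega
    · simp at h1
    · simp at h1
    · have := congrArg MM.n h1
      simp only at this
      omega
  refine ⟨hp, fun r => ?_⟩
  have h1 : (smap.comp (FreeMonoid.lift fun x => sR (r x))) (FreeMonoid.ofList w) =
    (smap.comp (FreeMonoid.lift fun x => sR (r x))) (FreeMonoid.ofList w') :=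
      congrArg smap (h (FreeMonoid.lift fun x => sR (r x)))
  rw [eval_eq, eval_eq] at h1
  simpa [smap_sR, (hp.map fun x => sw (r x)).sum_eq] using h1

/-- The Kauffman monoid `K₃` and the monoid `S₂¹` satisfy exactly the same identities:
an identity `w ≍ w'` holds in `K₃` if and only if it holds in `S₂¹`. -/
theorem K3_S21_same_identities (w w' : List ℕ) :
    HoldsIn K3 w w' ↔ HoldsIn S21 w w' := by
  constructor
  · intro h
    exact (good_iff.1 (kgood h)).holds.of_inj smap
      (Function.LeftInverse.injective fun s => (sN_smap s).1)
  · intro h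
    exact (good_iff.2 (sgood h)).holds.of_inj kmap (Function.LeftInverse.injective kN_kmap)
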